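/- arXiv:1101.5050 — 4 statements merged into one kernel-verified Lean document; each statement's English description precedes it below -/
import Mathlib

section
/- Define Φ : (ℝ^n)* → ℝ^d by Φ(y) := (y(u_1)+λ_1, …, y(u_d)+λ_d). Then: (1) the image of Φ is exactly the affine solution space 𝔑_α := {x ∈ ℝ^d : Σ_{i=1}^d x_i a_i = α in 𝔪*}, equivalently {x : Σ_i x_i v_i = Σ_i λ_i v_i for all v ∈ ker π}; (2) Φ is injective (since u_1,…,u_d span ℝ^n); (3) for each i, Φ maps the hyperplane H_i onto 𝔑_α ∩ {x ∈ ℝ^d : x_i = 0} and the half-space H_i^{≥0} onto 𝔑_α ∩ {x : x_i ≥ 0}. In particular the hyperplane arrangement 𝒜 in (ℝ^n)* is identified with the arrangement cut out on 𝔑_α by the coordinate hyperplanes of ℝ^d. (Proposition 3.4 / 'pro:arrcut' of the paper.) -/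
/-- Proposition 3.4 (`pro:arrcut`): the affine map `Φ(y) = (y(uᵢ) + λᵢ)ᵢ` identifies
`(ℝⁿ)*` with the affine solution space `𝔑_α = {x ∈ ℝ^d : Σᵢ xᵢ aᵢ = α}`: its range is
`𝔑_α`, it is injective, and it carries each hyperplane `Hᵢ` onto `𝔑_α ∩ {xᵢ = 0}` and
each half-space `Hᵢ^{≥0}` onto `𝔑_α ∩ {xᵢ ≥ 0}`. -/
theorem arrangement_identified_with_solution_space
    (m n d : ℕ) (hn : 1 ≤ n) (hd : d = m + n)
    (π : (Fin d → ℝ) →ₗ[ℝ] (Fin n → ℝ)) (hπ : Function.Surjective π)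
    (u : Fin d → Fin n → ℝ) (hu : ∀ i, u i = π (Pi.single i 1))
    (a : Fin d → Module.Dual ℝ (LinearMap.ker π))
    (ha : ∀ (i : Fin d) (v : LinearMap.ker π), a i v = (v : Fin d → ℝ) i)
    (lam : Fin d → ℝ)
    (α : Module.Dual ℝ (LinearMap.ker π)) (hα : α = ∑ i, lam i • a i)
    (Φ : Module.Dual ℝ (Fin n → ℝ) → (Fin d → ℝ))
    (hΦ : ∀ y i, Φ y i = y (u i) + lam i)
    (N : Set (Fin d → ℝ)) (hN : N = {x | ∑ i, x i • a i = α}) :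
    Set.range Φ = N ∧
    Function.Injective Φ ∧
    (∀ i : Fin d,
      Φ '' {y | y (u i) + lam i = 0} = N ∩ {x | x i = 0} ∧
      Φ '' {y | 0 ≤ y (u i) + lam i} = N ∩ {x | 0 ≤ x i}) := by
  have key : ∀ (y : Module.Dual ℝ (Fin n → ℝ)) (v : Fin d → ℝ),
      y (π v) = ∑ i, v i * y (u i) := by
    intro y v
    conv_lhs => rw [pi_eq_sum_univ' v]
    simp only [map_sum, map_smul, smul_eq_mul, hu]
  have hmem : ∀ x, x ∈ N ↔ ∀ v ∈ LinearMap.ker π, ∑ i, x i * v i = ∑ i, lam i * v i := by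
    intro x
    simp only [hN, hα, Set.mem_ofPred_eq, LinearMap.ext_iff, Subtype.forall,
      LinearMap.sum_apply, LinearMap.smul_apply, ha, smul_eq_mul]
  have hrange : Set.range Φ = N := by
    ext x
    rw [hmem]
    constructor
    · rintro ⟨y, rfl⟩ v hv
      have h := key y v
      rw [LinearMap.mem_ker.mp hv, map_zero] at h
      simp only [hΦ, add_mul, Finset.sum_add_distrib, mul_comm (y _), ← h, zero_add]
    · intro hx
      let g : Module.Dual ℝ (Fin d → ℝ) := ∑ i, (x i - lam i) • LinearMap.proj i
      have hg : g ∈ LinearMap.range π.dualMap := by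
        rw [LinearMap.range_dualMap_eq_dualAnnihilator_ker, Submodule.mem_dualAnnihilator]
        intro v hv
        simp [g, sub_mul, hx v hv]
      obtain ⟨y, hy⟩ := hg
      refine ⟨y, funext fun i => ?_⟩
      have h : y (π (Pi.single i 1)) = g (Pi.single i 1) := LinearMap.congr_fun hy _
      rw [hΦ, hu, h]
      simp [g, Pi.single_apply]
  refine ⟨hrange, ?_, fun i => ?_⟩
  · intro y z hyz
    refine LinearMap.ext fun w => ?_
    obtain ⟨v, rfl⟩ := hπ w
    rw [key, key]
    refine Finset.sum_congr rfl fun i _ => ?_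
    have h := congrFun hyz i
    rw [hΦ, hΦ] at h
    rw [add_right_cancel h]
  · simp only [← hΦ, ← hrange]
    exact ⟨by rw [Set.inter_comm, ← Set.image_preimage_eq_inter_range]; rfl,
      by rw [Set.inter_comm, ← Set.image_preimage_eq_inter_range]; rfl⟩
end

section
/- Assume the arrangement 𝒜 is smooth (simple and regular) and Θ_cpt ≠ ∅. Then for every (z,w) ∈ ℂ^d × ℂ^d with St_𝒜(z,w) ≠ ∅ there exists ε ∈ Θ_cpt with St_𝒜(z,w) ∩ Δ_ε ≠ ∅. (This is the key combinatorial claim in the proof of Theorem 1.3 of the paper: every nonempty state set — every unbounded polytope of the arrangement and each of its subpolytopes — meets one of the bounded polytopes Δ_ε, ε ∈ Θ_cpt.) -/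
/-- A strictly positive vector on which finitely many nonzero linear forms are all nonzero. -/
theorem exists_pos_forall_sum_mul_ne_zero {ι : Type*} [Fintype ι] {d : ℕ} (a : ι → Fin d → ℝ)
    (ha : ∀ i, ∃ k, a i k ≠ 0) :
    ∃ s : Fin d → ℝ, (∀ k, 0 < s k) ∧ ∀ i, ∑ k, s k * a i k ≠ 0 := by
  classical
  let P : ι → Polynomial ℝ := fun i => ∑ k : Fin d, Polynomial.monomial (k : ℕ) (a i k)
  have hP : ∀ i, P i ≠ 0 := by
    intro i h0
    obtain ⟨k, hk⟩ := ha i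
    apply hk
    have := congrArg (fun q => Polynomial.coeff q (k : ℕ)) h0
    simpa [P, Polynomial.finsetSum_coeff, Polynomial.coeff_monomial, Fin.val_inj] using this
  have hprod : ∏ i, P i ≠ 0 := Finset.prod_ne_zero_iff.mpr fun i _ => hP i
  obtain ⟨x, hx, hxr⟩ := (Set.Ioi_infinite (0 : ℝ)).exists_notMem_finset (∏ i, P i).roots.toFinset
  refine ⟨fun k => x ^ (k : ℕ), fun k => pow_pos hx _, fun i h0 => hxr ?_⟩
  rw [Multiset.mem_toFinset, Polynomial.mem_roots hprod, Polynomial.IsRoot,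
    Polynomial.eval_prod]
  refine Finset.prod_eq_zero (Finset.mem_univ i) ?_
  simpa [P, Polynomial.eval_finsetSum, Polynomial.eval_monomial, mul_comm] using h0

/-- A linear functional on `ℝⁿ` is the dot product with some vector. -/
theorem exists_dotProduct_eq {n : ℕ} (f : (Fin n → ℝ) →ₗ[ℝ] ℝ) :
    ∃ y : Fin n → ℝ, ∀ x, f x = ∑ j, x j * y j :=
  ⟨fun j => f (Pi.single j 1), fun x => by
    rw [LinearMap.pi_apply_eq_sum_univ f x]
    refine Finset.sum_congr rfl fun j _ => ?_
    rw [smul_eq_mul]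
    congr 2
    ext i
    simp [Pi.single_apply, eq_comm]⟩

/-- A chamber is bounded if its spanning normals satisfy a strictly positive linear relation. -/
theorem isBounded_chamber_of_pos_relation {n d : ℕ} {u : Fin d → Fin n → ℝ} {lam ε r : Fin d → ℝ}
    (hspan : Submodule.span ℝ (Set.range u) = ⊤) (hε : ∀ i, ε i = 1 ∨ ε i = -1)
    (hr : ∀ i, 0 < r i) (hrel : ∑ i, (r i * ε i) • u i = 0) :
    Bornology.IsBounded {y : Fin n → ℝ | ∀ i, 0 ≤ ε i * ((∑ j, u i j * y j) + lam i)} := by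
  set C : ℝ := ∑ i, r i * ε i * lam i
  have key : ∀ y : Fin n → ℝ, (∀ i, 0 ≤ ε i * ((∑ j, u i j * y j) + lam i)) →
      ∀ i, |∑ j, u i j * y j| ≤ C / r i + |lam i| := by
    intro y hy i
    have hrel' : ∑ i, r i * ε i * ∑ j, u i j * y j = 0 := by
      have h := congrArg (fun x : Fin n → ℝ => x ⬝ᵥ y) hrel
      simp only [sum_dotProduct, smul_dotProduct, zero_dotProduct, smul_eq_mul] at h
      exact h
    have hsum : ∑ i, r i * (ε i * ((∑ j, u i j * y j) + lam i)) = C := by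
      simp only [mul_add, Finset.sum_add_distrib, ← mul_assoc] at hrel' ⊢
      rw [hrel', zero_add]
    have hle : r i * (ε i * ((∑ j, u i j * y j) + lam i)) ≤ C := by
      rw [← hsum]
      exact Finset.single_le_sum
        (f := fun i => r i * (ε i * ((∑ j, u i j * y j) + lam i)))
        (fun k _ => mul_nonneg (hr k).le (hy k)) (Finset.mem_univ i)
    have hle' : ε i * ((∑ j, u i j * y j) + lam i) ≤ C / r i := by
      rw [le_div_iff₀ (hr i)]; linarith
    have h0 := hy i
    have habs : |(∑ j, u i j * y j) + lam i| ≤ C / r i := by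
      rw [abs_le]
      rcases hε i with h | h <;> rw [h] at hle' h0 <;> constructor <;> linarith
    calc |∑ j, u i j * y j| = |((∑ j, u i j * y j) + lam i) - lam i| := by ring_nf
      _ ≤ |(∑ j, u i j * y j) + lam i| + |lam i| := abs_sub _ _
      _ ≤ _ := by gcongr
  have hcoef : ∀ j : Fin n, ∃ c : Fin d → ℝ, ∑ i, c i • u i = Pi.single j 1 := fun j =>
    (Submodule.mem_span_range_iff_exists_fun ℝ).mp (hspan ▸ Submodule.mem_top)
  choose c hc using hcoef
  rw [← Bornology.forall_isBounded_image_eval_iff]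
  intro j
  rw [isBounded_iff_forall_norm_le]
  refine ⟨∑ i, |c j i| * (C / r i + |lam i|), ?_⟩
  rintro _ ⟨y, hy, rfl⟩
  have hyj : y j = ∑ i, c j i * ∑ l, u i l * y l := by
    have h := congrArg (fun x : Fin n → ℝ => x ⬝ᵥ y) (hc j)
    simp only [sum_dotProduct, smul_dotProduct, single_dotProduct, one_mul] at h
    exact h.symm
  simp only [Function.eval, Real.norm_eq_abs]
  rw [hyj]
  refine (Finset.abs_sum_le_sum_abs _ _).trans (Finset.sum_le_sum fun i _ => ?_)
  rw [abs_mul]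
  exact mul_le_mul_of_nonneg_left (key y hy i) (abs_nonneg _)

/-- A nonempty bounded chamber has no nonzero recession direction. -/
theorem eq_zero_of_recession_of_isBounded {n d : ℕ} {u : Fin d → Fin n → ℝ} {lam ε : Fin d → ℝ}
    (hne : {y : Fin n → ℝ | ∀ i, 0 ≤ ε i * ((∑ j, u i j * y j) + lam i)}.Nonempty)
    (hb : Bornology.IsBounded
      {y : Fin n → ℝ | ∀ i, 0 ≤ ε i * ((∑ j, u i j * y j) + lam i)})
    {y : Fin n → ℝ} (hy : ∀ i, 0 ≤ ε i * ∑ j, u i j * y j) : y = 0 := by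
  obtain ⟨q, hq⟩ := hne
  obtain ⟨R, hR⟩ := isBounded_iff_forall_norm_le.mp hb
  by_contra hy0
  have hpos : 0 < ‖y‖ := norm_pos_iff.mpr hy0
  have hR0 : ‖q‖ ≤ R := hR q hq
  set t : ℝ := (R + ‖q‖ + 1) / ‖y‖
  have ht : 0 ≤ t := div_nonneg (by linarith [norm_nonneg q]) hpos.le
  have hmem := hR (q + t • y) (by
    intro i
    have hsum : ∑ j, u i j * (q + t • y) j = (∑ j, u i j * q j) + t * ∑ j, u i j * y j := by
      simp only [Pi.add_apply, Pi.smul_apply, smul_eq_mul, mul_add, Finset.sum_add_distrib,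
        Finset.mul_sum]
      congr 1
      exact Finset.sum_congr rfl fun j _ => by ring
    rw [hsum]
    have h1 := hq i
    have h2 := mul_nonneg ht (hy i)
    linarith)
  have hnorm : ‖t • y‖ = R + ‖q‖ + 1 := by
    rw [norm_smul, Real.norm_of_nonneg ht, div_mul_cancel₀ _ hpos.ne']
  have htri : ‖t • y‖ ≤ ‖q + t • y‖ + ‖q‖ := by
    simpa using norm_sub_le (q + t • y) q
  linarith

/-- Moving along a line inside all hyperplanes through `p`, but not parallel to every hyperplane,
one reaches a new hyperplane without leaving the closed face of `p`. -/
theorem exists_new_hyperplane_of_direction {n d : ℕ} {u : Fin d → Fin n → ℝ} {lam : Fin d → ℝ}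
    {p y : Fin n → ℝ} (hy : ∀ i, (∑ j, u i j * p j) + lam i = 0 → ∑ j, u i j * y j = 0)
    (hk : ∃ k, ∑ j, u k j * y j ≠ 0) :
    ∃ q : Fin n → ℝ,
      (∀ i, (0 ≤ (∑ j, u i j * p j) + lam i → 0 ≤ (∑ j, u i j * q j) + lam i) ∧
        ((∑ j, u i j * p j) + lam i ≤ 0 → (∑ j, u i j * q j) + lam i ≤ 0)) ∧
      ∃ k, (∑ j, u k j * p j) + lam k ≠ 0 ∧ (∑ j, u k j * q j) + lam k = 0 := by
  classical
  obtain ⟨k₀, hk₀⟩ := hk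
  obtain ⟨k, hkT, hmin⟩ := (Finset.univ.filter fun i => ∑ j, u i j * y j ≠ 0).exists_min_image
    (fun i => |(∑ j, u i j * p j) + lam i| / |∑ j, u i j * y j|) ⟨k₀, by simpa using hk₀⟩
  have hky : ∑ j, u k j * y j ≠ 0 := by simpa using hkT
  set t : ℝ := -((∑ j, u k j * p j) + lam k) / ∑ j, u k j * y j with ht
  have hval : ∀ i, (∑ j, u i j * (p + t • y) j) + lam i =
      ((∑ j, u i j * p j) + lam i) + t * ∑ j, u i j * y j := by
    intro i
    have : ∑ j, u i j * (p + t • y) j = (∑ j, u i j * p j) + t * ∑ j, u i j * y j := by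
      simp only [Pi.add_apply, Pi.smul_apply, smul_eq_mul, mul_add, Finset.sum_add_distrib,
        Finset.mul_sum]
      congr 1
      exact Finset.sum_congr rfl fun j _ => by ring
    rw [this]; ring
  refine ⟨p + t • y, fun i => ?_, k, fun h => hky (hy k h), ?_⟩
  · have hle : |t * ∑ j, u i j * y j| ≤ |(∑ j, u i j * p j) + lam i| := by
      by_cases hi : ∑ j, u i j * y j = 0
      · rw [hi]; simp
      · have h := hmin i (by simpa using hi)
        rwa [le_div_iff₀ (abs_pos.mpr hi), ← abs_neg (_ + lam k), ← abs_div, ← ht,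
          ← abs_mul] at h
    rw [hval]
    constructor
    · intro h
      rw [abs_of_nonneg h] at hle
      linarith [neg_le_of_abs_le hle]
    · intro h
      rw [abs_of_nonpos h] at hle
      linarith [le_of_abs_le hle]
  · rw [hval, ht, div_mul_cancel₀ _ hky]; ring

/-- If the normals span, every closed face of the arrangement contains a point at which the
normals of the active hyperplanes span. -/
theorem exists_vertex_of_closed_face {n d : ℕ} {u : Fin d → Fin n → ℝ} (lam : Fin d → ℝ)
    (hspan : Submodule.span ℝ (Set.range u) = ⊤) (p : Fin n → ℝ) :
    ∃ v : Fin n → ℝ,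
      (∀ i, (0 ≤ (∑ j, u i j * p j) + lam i → 0 ≤ (∑ j, u i j * v j) + lam i) ∧
        ((∑ j, u i j * p j) + lam i ≤ 0 → (∑ j, u i j * v j) + lam i ≤ 0)) ∧
      Submodule.span ℝ (u '' {i | (∑ j, u i j * v j) + lam i = 0}) = ⊤ := by
  set F : Set (Fin n → ℝ) := {v | ∀ i,
    (0 ≤ (∑ j, u i j * p j) + lam i → 0 ≤ (∑ j, u i j * v j) + lam i) ∧
      ((∑ j, u i j * p j) + lam i ≤ 0 → (∑ j, u i j * v j) + lam i ≤ 0)}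
  set act : (Fin n → ℝ) → Set (Fin d) := fun v => {i | (∑ j, u i j * v j) + lam i = 0}
  obtain ⟨v, hv⟩ := (Set.toFinite (act '' F)).exists_maximalFor id _
    ⟨act p, Set.mem_image_of_mem _ fun i => ⟨id, id⟩⟩
  obtain ⟨⟨v, hvF, rfl⟩, hmax⟩ := hv
  refine ⟨v, hvF, ?_⟩
  by_contra hlt
  obtain ⟨f, hf0, hf⟩ := Submodule.exists_le_ker_of_lt_top _ (lt_top_iff_ne_top.mpr hlt)
  obtain ⟨y, hy⟩ := exists_dotProduct_eq f
  obtain ⟨q, hq, k, hkv, hkq⟩ := exists_new_hyperplane_of_direction (u := u) (lam := lam)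
    (p := v) (y := y)
    (fun i hi => by
      rw [← hy]
      exact hf (Submodule.subset_span (Set.mem_image_of_mem u hi)))
    (by
      by_contra! h
      apply hf0
      rw [← LinearMap.ker_eq_top, eq_top_iff, ← hspan, Submodule.span_le]
      rintro _ ⟨i, rfl⟩
      exact (hy _).trans (h i))
  refine hkv (hmax (j := act q) ⟨q, fun i => ⟨fun h => (hq i).1 ((hvF i).1 h),
    fun h => (hq i).2 ((hvF i).2 h)⟩, rfl⟩ (fun i hi => ?_) hkq)
  exact le_antisymm ((hq i).2 (le_of_eq hi)) ((hq i).1 (ge_of_eq hi))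

/-- In a simple arrangement with a nonempty bounded chamber, every vertex lies on a bounded
chamber. -/
theorem exists_bounded_chamber_of_vertex {n d : ℕ} {u : Fin d → Fin n → ℝ} {lam : Fin d → ℝ}
    {v : Fin n → ℝ} {A : Finset (Fin d)} (hA : ∀ i, i ∈ A ↔ (∑ j, u i j * v j) + lam i = 0)
    (hli : LinearIndependent ℝ (fun i : A => u i))
    (hsp : Submodule.span ℝ (u '' A) = ⊤)
    (hcore : ∃ ε₀ : Fin d → ℝ, (∀ i, ε₀ i = 1 ∨ ε₀ i = -1) ∧
        {y : Fin n → ℝ | ∀ i, 0 ≤ ε₀ i * ((∑ j, u i j * y j) + lam i)}.Nonempty ∧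
        Bornology.IsBounded
          {y : Fin n → ℝ | ∀ i, 0 ≤ ε₀ i * ((∑ j, u i j * y j) + lam i)}) :
    ∃ ε : Fin d → ℝ, (∀ i, ε i = 1 ∨ ε i = -1) ∧
      Bornology.IsBounded
        {y : Fin n → ℝ | ∀ i, 0 ≤ ε i * ((∑ j, u i j * y j) + lam i)} ∧
      ∀ i, 0 ≤ ε i * ((∑ j, u i j * v j) + lam i) := by
  classical
  obtain ⟨ε₀, hε₀, hne, hb⟩ := hcore
  have hsp' : ⊤ ≤ Submodule.span ℝ (Set.range fun i : A => u i) := by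
    rw [← hsp, Set.image_eq_range]; rfl
  let b : Module.Basis A ℝ (Fin n → ℝ) := Module.Basis.mk hli hsp'
  have hb_apply : ∀ i : A, b i = u i := fun i => Module.Basis.mk_apply hli hsp' i
  set τ : Fin d → ℝ := fun k => if 0 ≤ (∑ j, u k j * v j) + lam k then 1 else -1 with hτ
  have hτ1 : ∀ k, τ k = 1 ∨ τ k = -1 := fun k => by simp only [hτ]; split_ifs <;> simp
  have hτv : ∀ k, 0 ≤ τ k * ((∑ j, u k j * v j) + lam k) := fun k => by
    simp only [hτ]; split_ifs with h <;> linarith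
  obtain ⟨s, hs, hsum⟩ := exists_pos_forall_sum_mul_ne_zero
    (fun (i : A) k => if k ∈ A then 0 else τ k * b.coord i (u k)) (by
      intro i
      by_contra! h
      obtain ⟨y, hy⟩ := exists_dotProduct_eq (b.coord i)
      have hii : ∑ j, u i j * y j = 1 := by
        rw [← hy, ← hb_apply]; simp
      have hki : ∀ k : Fin d, k ≠ i → ∑ j, u k j * y j = 0 := by
        intro k hk
        rw [← hy]
        by_cases hkA : k ∈ A
        · have := hb_apply ⟨k, hkA⟩
          simp only at this
          rw [← this, Module.Basis.coord_apply, Module.Basis.repr_self,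
            Finsupp.single_apply, if_neg]
          exact fun h => hk (congrArg Subtype.val h)
        · have hk' := h k
          rw [if_neg hkA] at hk'
          exact (mul_eq_zero.mp hk').resolve_left (by rcases hτ1 k with h | h <;> simp [h])
      have hsmul : ∀ k, ∑ j, u k j * (ε₀ i • y) j = ε₀ i * ∑ j, u k j * y j := fun k => by
        simp only [Pi.smul_apply, smul_eq_mul, Finset.mul_sum]
        exact Finset.sum_congr rfl fun j _ => by ring
      have hzero := eq_zero_of_recession_of_isBounded hne hb (y := ε₀ i • y) fun k => by
        rw [hsmul]
        by_cases hk : k = i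
        · rw [hk, ← mul_assoc, hii, mul_one]; exact mul_self_nonneg _
        · rw [hki k hk]; simp
      have hcontra := hsmul i
      rw [hzero, hii] at hcontra
      rcases hε₀ i with h | h <;> simp [h] at hcontra)
  set W : Fin n → ℝ := ∑ k, if k ∈ A then 0 else (s k * τ k) • u k with hW
  set c : Fin d → ℝ := fun i => if h : i ∈ A then b.coord ⟨i, h⟩ W else 0 with hc
  have hc0 : ∀ i ∈ A, c i ≠ 0 := by
    intro i hi
    simp only [hc, dif_pos hi, hW, map_sum]
    convert hsum ⟨i, hi⟩ using 3 with k
    split_ifs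
    · simp
    · simp [mul_assoc]
  have hWc : W = ∑ i, if i ∈ A then c i • u i else 0 := by
    rw [← Finset.sum_filter, Finset.filter_mem_eq_inter, Finset.univ_inter,
      ← Finset.sum_coe_sort A]
    conv_lhs => rw [← b.sum_repr W]
    refine Finset.sum_congr rfl fun i _ => ?_
    rw [hb_apply, hc]
    simp
  refine ⟨fun i => if i ∈ A then (if 0 ≤ c i then -1 else 1) else τ i, fun i => ?_,
    isBounded_chamber_of_pos_relation (r := fun i => if i ∈ A then |c i| else s i) ?_ ?_ ?_ ?_,
    fun i => ?_⟩
  · dsimp only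
    split_ifs
    · simp
    · simp
    · exact hτ1 i
  · rw [eq_top_iff, ← hsp]
    exact Submodule.span_mono (Set.image_subset_range _ _)
  · intro i
    split_ifs
    · simp
    · simp
    · exact hτ1 i
  · intro i
    split_ifs with h
    · exact abs_pos.mpr (hc0 i h)
    · exact hs i
  · have : ∀ i, ((if i ∈ A then |c i| else s i) *
        (if i ∈ A then (if 0 ≤ c i then -1 else 1) else τ i)) • u i =
        (if i ∈ A then 0 else (s i * τ i) • u i) - (if i ∈ A then c i • u i else 0) := by
      intro i
      split_ifs with h h'
      · rw [abs_of_nonneg h']; simp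
      · rw [abs_of_neg (not_le.mp h')]; simp
      · simp
    simp only [this]
    rw [Finset.sum_sub_distrib, ← hWc, ← hW, sub_self]
  · by_cases h : i ∈ A
    · rw [(hA i).mp h, mul_zero]
    · simpa only [if_neg h] using hτv i


/-- Key combinatorial claim in the proof of Theorem 1.3: for a smooth arrangement with
nonempty core, every nonempty state set `St_𝒜(z,w)` meets one of the bounded polytopes
`Δ_ε`, `ε ∈ Θ_cpt`. -/
theorem nonempty_state_set_meets_bounded_polytope
    (m n d : ℕ) (hn : 1 ≤ n) (hd : d = m + n)
    (π : (Fin d → ℝ) →ₗ[ℝ] (Fin n → ℝ)) (hπ : Function.Surjective π)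
    (u : Fin d → Fin n → ℝ) (hu : ∀ i, u i = π (Pi.single i 1))
    (lam : Fin d → ℝ)
    -- 𝒜 is simple
    (hsimple : ∀ S : Finset (Fin d),
        (⋂ i ∈ S, {y : Fin n → ℝ | (∑ j, u i j * y j) + lam i = 0}).Nonempty →
        LinearIndependent ℝ (fun i : S => u i))
    -- 𝒜 is regular
    (hint : ∀ i j, ∃ k : ℤ, u i j = (k : ℝ))
    (hreg : ∀ S : Finset (Fin d), S.card = n →
        LinearIndependent ℝ (fun i : S => u i) →
        Submodule.span ℤ (Set.range fun i : S => u i) =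
          Submodule.span ℤ (Set.range fun j : Fin n => (Pi.single j 1 : Fin n → ℝ)))
    -- the core is nonempty: Θ_cpt ≠ ∅
    (hcore : ∃ ε₀ : Fin d → ℝ, (∀ i, ε₀ i = 1 ∨ ε₀ i = -1) ∧
        {y : Fin n → ℝ | ∀ i, 0 ≤ ε₀ i * ((∑ j, u i j * y j) + lam i)}.Nonempty ∧
        Bornology.IsBounded
          {y : Fin n → ℝ | ∀ i, 0 ≤ ε₀ i * ((∑ j, u i j * y j) + lam i)})
    (z w : Fin d → ℂ)
    (hSt : (⋂ i : Fin d,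
        (if z i = 0 then {y : Fin n → ℝ | (∑ j, u i j * y j) + lam i = 0}
         else {y : Fin n → ℝ | 0 ≤ (∑ j, u i j * y j) + lam i}) ∪
        (if w i = 0 then {y : Fin n → ℝ | (∑ j, u i j * y j) + lam i = 0}
         else {y : Fin n → ℝ | (∑ j, u i j * y j) + lam i ≤ 0})).Nonempty) :
    ∃ ε : Fin d → ℝ, (∀ i, ε i = 1 ∨ ε i = -1) ∧
      {y : Fin n → ℝ | ∀ i, 0 ≤ ε i * ((∑ j, u i j * y j) + lam i)}.Nonempty ∧
      Bornology.IsBounded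
        {y : Fin n → ℝ | ∀ i, 0 ≤ ε i * ((∑ j, u i j * y j) + lam i)} ∧
      ((⋂ i : Fin d,
        (if z i = 0 then {y : Fin n → ℝ | (∑ j, u i j * y j) + lam i = 0}
         else {y : Fin n → ℝ | 0 ≤ (∑ j, u i j * y j) + lam i}) ∪
        (if w i = 0 then {y : Fin n → ℝ | (∑ j, u i j * y j) + lam i = 0}
         else {y : Fin n → ℝ | (∑ j, u i j * y j) + lam i ≤ 0})) ∩
       {y : Fin n → ℝ | ∀ i, 0 ≤ ε i * ((∑ j, u i j * y j) + lam i)}).Nonempty := by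
  classical
  have hspan : Submodule.span ℝ (Set.range u) = ⊤ := by
    rw [eq_top_iff, ← LinearMap.range_eq_top.mpr hπ]
    rintro _ ⟨x, rfl⟩
    rw [LinearMap.pi_apply_eq_sum_univ π x]
    refine Submodule.sum_mem _ fun i _ => Submodule.smul_mem _ _ (Submodule.subset_span ⟨i, ?_⟩)
    rw [hu]
    congr 1
    ext k
    simp [Pi.single_apply, eq_comm]
  obtain ⟨p, hp⟩ := hSt
  obtain ⟨v, hpv, hvspan⟩ := exists_vertex_of_closed_face lam hspan p
  set A : Finset (Fin d) := Finset.univ.filter fun i => (∑ j, u i j * v j) + lam i = 0 with hAdef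
  have hA : ∀ i, i ∈ A ↔ (∑ j, u i j * v j) + lam i = 0 := by simp [hAdef]
  have hli := hsimple A ⟨v, Set.mem_iInter₂.mpr fun i hi => (hA i).mp hi⟩
  have hsp : Submodule.span ℝ (u '' A) = ⊤ := by
    rw [← hvspan]
    congr 2
    ext i
    exact hA i
  obtain ⟨ε, hε, hbdd, hεv⟩ := exists_bounded_chamber_of_vertex hA hli hsp hcore
  refine ⟨ε, hε, ⟨v, hεv⟩, hbdd, v, Set.mem_iInter.mpr fun i => ?_, hεv⟩
  have hpi := Set.mem_iInter.mp hp i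
  have hzero : (∑ j, u i j * p j) + lam i = 0 → (∑ j, u i j * v j) + lam i = 0 := fun h =>
    le_antisymm ((hpv i).2 h.le) ((hpv i).1 h.ge)
  refine hpi.imp (fun h => ?_) (fun h => ?_)
  · split_ifs at h ⊢
    · exact hzero h
    · exact (hpv i).1 h
  · split_ifs at h ⊢
    · exact hzero h
    · exact (hpv i).2 h
end

section
/- Let J ⊆ {1,…,d}. Then α lies in the convex cone generated by {a_i : i ∉ J} (equivalently, any point z ∈ ℂ^d with z_i = 0 exactly for i ∈ J is α-semi-stable) if and only if the hyperplanes {H_i : i ∈ J} have a common point inside the polytope Δ := ∩_{i=1}^d H_i^{≥0}, i.e. Δ ∩ (∩_{i∈J} H_i) ≠ ∅. (Remark following Proposition 1.1 in the paper, giving the hyperplane-arrangement replacement for the set ℂ^d_Δ of Guillemin and Bielawski–Dancer.) -/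
/-- Gale duality: the linear relations among the restrictions `aᵢ` of the coordinate functionals
to `ker π` are exactly the vectors `(y (uᵢ))ᵢ` for `y` in the dual of the target. -/
theorem sum_smul_coord_ker_eq_zero_iff {ι K V : Type*} [Fintype ι] [DecidableEq ι] [Field K]
    [AddCommGroup V] [Module K V] (π : (ι → K) →ₗ[K] V)
    (a : ι → Module.Dual K (LinearMap.ker π))
    (ha : ∀ (i : ι) (v : LinearMap.ker π), a i v = (v : ι → K) i) (c : ι → K) :
    ∑ i, c i • a i = 0 ↔ ∃ y : Module.Dual K V, ∀ i, y (π (Pi.single i 1)) = c i := by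
  constructor
  · intro h
    have hmem : Fintype.linearCombination K c ∈ LinearMap.range π.dualMap := by
      rw [LinearMap.range_dualMap_eq_dualAnnihilator_ker, Submodule.mem_dualAnnihilator]
      intro v hv
      have hv0 := LinearMap.congr_fun h ⟨v, hv⟩
      simpa [ha, Fintype.linearCombination_apply, mul_comm] using hv0
    obtain ⟨y, hy⟩ := hmem
    refine ⟨y, fun i => ?_⟩
    have hyi := LinearMap.congr_fun hy (Pi.single i 1)
    simpa using hyi
  · rintro ⟨y, hy⟩
    ext v
    have hv : y (π v) = 0 := by rw [LinearMap.mem_ker.mp v.2, map_zero]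
    rw [pi_eq_sum_univ' (v : ι → K)] at hv
    simpa [ha, ← hy, mul_comm, ← Pi.single_apply, Pi.single_comm] using hv


/-- Remark after Proposition 1.1: `α` lies in the convex cone generated by
`{aᵢ : i ∉ J}` (i.e. any point `z` with `zᵢ = 0` exactly for `i ∈ J` is
`α`-semi-stable) iff the hyperplanes `{Hᵢ : i ∈ J}` have a common point inside the
polytope `Δ = ⋂ᵢ Hᵢ^{≥0}`. -/
theorem cone_membership_iff_hyperplanes_meet_polytope
    (m n d : ℕ) (hn : 1 ≤ n) (hd : d = m + n)
    (π : (Fin d → ℝ) →ₗ[ℝ] (Fin n → ℝ)) (hπ : Function.Surjective π)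
    (u : Fin d → Fin n → ℝ) (hu : ∀ i, u i = π (Pi.single i 1))
    (a : Fin d → Module.Dual ℝ (LinearMap.ker π))
    (ha : ∀ (i : Fin d) (v : LinearMap.ker π), a i v = (v : Fin d → ℝ) i)
    (lam : Fin d → ℝ)
    (α : Module.Dual ℝ (LinearMap.ker π)) (hα : α = ∑ i, lam i • a i)
    (J : Finset (Fin d)) :
    (∃ t : Fin d → ℝ, (∀ i, 0 ≤ t i) ∧ α = ∑ i ∈ Jᶜ, t i • a i) ↔
      ((⋂ i : Fin d, {y : Module.Dual ℝ (Fin n → ℝ) | 0 ≤ y (u i) + lam i}) ∩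
        ⋂ i ∈ J, {y : Module.Dual ℝ (Fin n → ℝ) | y (u i) + lam i = 0}).Nonempty := by
  have key := sum_smul_coord_ker_eq_zero_iff π a ha
  simp only [← hu] at key
  subst hα
  constructor
  · rintro ⟨t, ht, hsum⟩
    have hc : ∑ i, ((if i ∈ J then 0 else t i) - lam i) • a i = 0 := by
      ext v
      have hv := LinearMap.congr_fun hsum v
      have hcompl : Finset.univ.filter (· ∉ J) = Jᶜ := by ext i; simp
      simp only [LinearMap.sum_apply, LinearMap.smul_apply, smul_eq_mul] at hv
      simp [sub_mul, Finset.sum_ite, hcompl, hv]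
    obtain ⟨y, hy⟩ := (key _).1 hc
    refine ⟨y, ?_, ?_⟩
    · simp only [Set.mem_iInter, Set.mem_ofPred_eq, hy, sub_add_cancel]
      intro i
      split_ifs
      exacts [le_rfl, ht i]
    · simp +contextual [hy]
  · rintro ⟨y, hΔ, hJ⟩
    simp only [Set.mem_iInter, Set.mem_ofPred_eq] at hΔ hJ
    refine ⟨fun i => y (u i) + lam i, hΔ, ?_⟩
    have hfull : ∑ i ∈ Jᶜ, (y (u i) + lam i) • a i = ∑ i, (y (u i) + lam i) • a i :=
      Finset.sum_subset (Finset.subset_univ _) fun i _ hi => by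
        rw [hJ i (by simpa using hi), zero_smul]
    rw [hfull]
    simp only [add_smul, Finset.sum_add_distrib]
    rw [(key fun i => y (u i)).2 ⟨y, fun _ => rfl⟩, zero_add]
end

section
/- Assume the arrangement 𝒜 is simple and u_1,…,u_d span ℝ^n (n ≥ 1). Then there is NO ε : {1,…,d} → {+1,−1} for which Δ_ε is bounded, nonempty and n-dimensional (has nonempty interior) if and only if there exists an index k ∈ {1,…,d} such that u_k does not lie in the linear span of the other vectors {u_i : i ≠ k}. Equivalently: the arrangement contains a bounded n-dimensional polytope among the regions Δ_ε (the toric hyperkähler manifold has nonempty core) if and only if every u_k lies in the span of the remaining u_i. (Criterion for nonemptiness of the core, Section 4.1 of the paper.) -/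
open Filter Topology in
/-- Finitely many strict inequalities survive a small positive displacement. -/
theorem exists_pos_forall_pos_add_mul {ι : Type*} (s : Finset ι) (g h : ι → ℝ)
    (hg : ∀ j ∈ s, 0 < g j) : ∃ t : ℝ, 0 < t ∧ ∀ j ∈ s, 0 < g j + t * h j := by
  have key : ∀ᶠ t in 𝓝[>] (0 : ℝ), ∀ j ∈ s, 0 < g j + t * h j := by
    refine (eventually_all_finset s).2 fun j hj => ?_
    have hc : Continuous fun t : ℝ => g j + t * h j := by fun_prop
    exact nhdsWithin_le_nhds (hc.continuousAt.eventually_const_lt (by simpa using hg j hj))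
  obtain ⟨t, ht, ht0⟩ := (key.and self_mem_nhdsWithin).exists
  exact ⟨t, ht0, ht⟩

theorem exists_sign_mul_pos {x : ℝ} (hx : x ≠ 0) : ∃ σ : ℝ, (σ = 1 ∨ σ = -1) ∧ 0 < σ * x := by
  rcases hx.lt_or_gt with h | h
  · exact ⟨-1, Or.inr rfl, by linarith⟩
  · exact ⟨1, Or.inl rfl, by linarith⟩

/-- Existence of a bounded open region in the arrangement that the hyperplanes
`ℓ i + c i = 0`, `i ∈ s`, cut out on the flat `⋂ i ∈ T, {ℓ i + c i = 0}`. Boundedness is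
expressed by an upper bound for every linear functional. -/
theorem exists_bounded_region {ι V : Type*} [DecidableEq ι] [AddCommGroup V] [Module ℝ V]
    (ℓ : ι → V →ₗ[ℝ] ℝ) (c : ι → ℝ)
    (hgen : ∀ (T : Finset ι) (y : V), (∀ j ∈ T, ℓ j y + c j = 0) → ∀ i ∉ T, ℓ i y + c i = 0 →
      ∃ v, (∀ j ∈ T, ℓ j v = 0) ∧ ℓ i v ≠ 0)
    (s T : Finset ι) (hdisj : Disjoint s T)
    (hflat : ∃ y, ∀ j ∈ T, ℓ j y + c j = 0)
    (hspan : ∀ v, (∀ j ∈ T, ℓ j v = 0) → (∀ j ∈ s, ℓ j v = 0) → v = 0)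
    (hcoloop : ∀ k ∈ s, ∀ v, (∀ j ∈ T, ℓ j v = 0) → (∀ j ∈ s, j ≠ k → ℓ j v = 0) → v = 0) :
    ∃ ε : ι → ℝ, (∀ i, ε i = 1 ∨ ε i = -1) ∧
      (∃ y, (∀ j ∈ T, ℓ j y + c j = 0) ∧ ∀ j ∈ s, 0 < ε j * (ℓ j y + c j)) ∧
      ∀ φ : V →ₗ[ℝ] ℝ, ∃ C : ℝ, ∀ z, (∀ j ∈ T, ℓ j z + c j = 0) →
        (∀ j ∈ s, 0 ≤ ε j * (ℓ j z + c j)) → φ z ≤ C := by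
  induction hcard : s.card generalizing s T with
  | zero =>
    obtain rfl := Finset.card_eq_zero.1 hcard
    obtain ⟨y, hy⟩ := hflat
    refine ⟨fun _ => 1, fun _ => Or.inl rfl, ⟨y, hy, by simp⟩, fun φ => ⟨φ y, fun z hz _ => ?_⟩⟩
    have : z - y = 0 := hspan _
      (fun j hj => by rw [map_sub]; linarith [hz j hj, hy j hj]) (by simp)
    rw [sub_eq_zero.1 this]
  | succ N ih =>
    obtain ⟨i, his⟩ : s.Nonempty := Finset.card_pos.1 (by omega)
    have hiT : i ∉ T := Finset.disjoint_left.1 hdisj his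
    have hcard' : (s.erase i).card = N := by rw [Finset.card_erase_of_mem his]; omega
    have hspan' : ∀ v, (∀ j ∈ T, ℓ j v = 0) → (∀ j ∈ s.erase i, ℓ j v = 0) → v = 0 :=
      fun v hT hs => hcoloop i his v hT fun j hj hji => hs j (Finset.mem_erase.2 ⟨hji, hj⟩)
    by_cases hdel : ∀ k ∈ s.erase i, ∀ v, (∀ j ∈ T, ℓ j v = 0) →
        (∀ j ∈ s.erase i, j ≠ k → ℓ j v = 0) → v = 0
    · obtain ⟨ε, hε, ⟨y, hyT, hys⟩, hb⟩ := ih (s.erase i) T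
        (hdisj.mono_left (Finset.erase_subset _ _)) hflat hspan' hdel hcard'
      obtain ⟨y', hyT', hys', hyi'⟩ : ∃ y', (∀ j ∈ T, ℓ j y' + c j = 0) ∧
          (∀ j ∈ s.erase i, 0 < ε j * (ℓ j y' + c j)) ∧ ℓ i y' + c i ≠ 0 := by
        by_cases hyi : ℓ i y + c i = 0
        · obtain ⟨v, hvT, hvi⟩ := hgen T y hyT i hiT hyi
          obtain ⟨t, ht, hts⟩ := exists_pos_forall_pos_add_mul (s.erase i)
            (fun j => ε j * (ℓ j y + c j)) (fun j => ε j * ℓ j v) hys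
          refine ⟨y + t • v, fun j hj => ?_, fun j hj => ?_, ?_⟩
          · simp [hvT j hj, hyT j hj]
          · have := hts j hj
            simp only [map_add, map_smul, smul_eq_mul]
            linarith
          · have : ℓ i (y + t • v) + c i = t * ℓ i v := by
              simp only [map_add, map_smul, smul_eq_mul]
              linarith
            rw [this]
            exact mul_ne_zero ht.ne' hvi
        · exact ⟨y, hyT, hys, hyi⟩
      obtain ⟨σ, hσ, hσi⟩ := exists_sign_mul_pos hyi'
      refine ⟨Function.update ε i σ, fun j => ?_, ⟨y', hyT', fun j hj => ?_⟩, fun φ => ?_⟩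
      · by_cases hji : j = i
        · subst hji; simpa using hσ
        · simpa [hji] using hε j
      · by_cases hji : j = i
        · subst hji; simpa using hσi
        · simpa [hji] using hys' j (Finset.mem_erase.2 ⟨hji, hj⟩)
      · obtain ⟨C, hC⟩ := hb φ
        refine ⟨C, fun z hzT hzs => hC z hzT fun j hj => ?_⟩
        obtain ⟨hji, hj⟩ := Finset.mem_erase.1 hj
        simpa [hji] using hzs j hj
    · push Not at hdel
      obtain ⟨k, hk, v, hvT, hvs, hv0⟩ := hdel
      obtain ⟨hki, hks⟩ := Finset.mem_erase.1 hk
      have hvi : ℓ i v ≠ 0 := fun h => hv0 <| hcoloop k hks v hvT fun j hj hjk => by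
        by_cases hji : j = i
        · rwa [hji]
        · exact hvs j (Finset.mem_erase.2 ⟨hji, hj⟩) hjk
      have hvk : ℓ k v ≠ 0 := fun h => hv0 <| hspan' v hvT fun j hj => by
        by_cases hjk : j = k
        · rwa [hjk]
        · exact hvs j hj hjk
      obtain ⟨ε, hε, ⟨y, hyT, hys⟩, hb⟩ := ih (s.erase i) (insert i T)
        (by
          rw [Finset.disjoint_insert_right]
          exact ⟨Finset.notMem_erase i s, hdisj.mono_left (Finset.erase_subset _ _)⟩)
        (by
          obtain ⟨y, hy⟩ := hflat
          refine ⟨y - ((ℓ i y + c i) / ℓ i v) • v, fun j hj => ?_⟩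
          rcases Finset.mem_insert.1 hj with rfl | hj
          · simp only [map_sub, map_smul, smul_eq_mul]
            field_simp
            ring
          · simp [hvT j hj, hy j hj])
        (fun w hT hs => hspan' w (fun j hj => hT j (Finset.mem_insert_of_mem hj)) hs)
        (fun k' hk' w hT hs => hcoloop k' (Finset.mem_of_mem_erase hk') w
          (fun j hj => hT j (Finset.mem_insert_of_mem hj)) fun j hj hjk => by
            by_cases hji : j = i
            · rw [hji]; exact hT i (Finset.mem_insert_self _ _)
            · exact hs j (Finset.mem_erase.2 ⟨hji, hj⟩) hjk)
        hcard'
      have hεk : ε k ≠ 0 := by rcases hε k with h | h <;> simp [h]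
      obtain ⟨w, hwT, hws, hwk, hwi⟩ : ∃ w, (∀ j ∈ T, ℓ j w = 0) ∧
          (∀ j ∈ s.erase i, j ≠ k → ℓ j w = 0) ∧ ε k * ℓ k w = -1 ∧ ℓ i w ≠ 0 := by
        refine ⟨(-(ε k * ℓ k v)⁻¹) • v, fun j hj => by simp [hvT j hj],
          fun j hj hjk => by simp [hvs j hj hjk], ?_, ?_⟩
        · simp only [map_smul, smul_eq_mul]
          field_simp
        · simp [hvi, hεk, hvk]
      obtain ⟨σ, hσ, hσi⟩ := exists_sign_mul_pos hwi
      have hyi : ℓ i y + c i = 0 := hyT i (Finset.mem_insert_self _ _)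
      refine ⟨Function.update ε i σ, fun j => ?_, ?_, fun φ => ?_⟩
      · by_cases hji : j = i
        · subst hji; simpa using hσ
        · simpa [hji] using hε j
      · obtain ⟨t, ht, hts⟩ := exists_pos_forall_pos_add_mul (s.erase i)
          (fun j => ε j * (ℓ j y + c j)) (fun j => ε j * ℓ j w) hys
        refine ⟨y + t • w, fun j hj => ?_, fun j hj => ?_⟩
        · simp [hwT j hj, hyT j (Finset.mem_insert_of_mem hj)]
        · by_cases hji : j = i
          · subst hji
            have : σ * (ℓ j (y + t • w) + c j) = t * (σ * ℓ j w) := by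
              simp only [map_add, map_smul, smul_eq_mul]
              linear_combination σ * hyi
            rw [Function.update_self, this]
            positivity
          · have := hts j (Finset.mem_erase.2 ⟨hji, hj⟩)
            rw [Function.update_of_ne hji]
            simp only [map_add, map_smul, smul_eq_mul]
            linarith
      · obtain ⟨C, hC⟩ := hb φ
        obtain ⟨D, hD⟩ := hb (ε k • ℓ k)
        refine ⟨C + (D + ε k * c k) * |φ w|, fun z hzT hzs => ?_⟩
        -- Project `z` along `w` to the hyperplane indexed by `i`.
        obtain ⟨t, ht⟩ : ∃ t, t = (ℓ i z + c i) / ℓ i w := ⟨_, rfl⟩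
        have hti : t * ℓ i w = ℓ i z + c i := by rw [ht]; field_simp
        have ht0 : 0 ≤ t := by
          have h1 : 0 ≤ σ * (ℓ i z + c i) := by simpa using hzs i his
          rw [← hti] at h1
          exact nonneg_of_mul_nonneg_left (by linarith : 0 ≤ t * (σ * ℓ i w)) hσi
        have hzk : 0 ≤ ε k * (ℓ k z + c k) := by simpa [hki] using hzs k hks
        have hxk : ε k * (ℓ k (z - t • w) + c k) = ε k * (ℓ k z + c k) + t := by
          simp only [map_sub, map_smul, smul_eq_mul]
          linear_combination -t * hwk
        have hxT : ∀ j ∈ insert i T, ℓ j (z - t • w) + c j = 0 := by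
          intro j hj
          rcases Finset.mem_insert.1 hj with rfl | hj
          · simp only [map_sub, map_smul, smul_eq_mul]
            linarith
          · simp [hwT j hj, hzT j hj]
        have hxs : ∀ j ∈ s.erase i, 0 ≤ ε j * (ℓ j (z - t • w) + c j) := by
          intro j hj
          by_cases hjk : j = k
          · rw [hjk, hxk]; positivity
          · obtain ⟨hji, hjs⟩ := Finset.mem_erase.1 hj
            simpa [hws j hj hjk, hji] using hzs j hjs
        have h1 := hC _ hxT hxs
        have h2 := hD _ hxT hxs
        have h3 : t ≤ D + ε k * c k := by
          simp only [LinearMap.smul_apply, smul_eq_mul] at h2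
          linarith
        have h4 : t * φ w ≤ (D + ε k * c k) * |φ w| :=
          (mul_le_mul_of_nonneg_left (le_abs_self _) ht0).trans
            (mul_le_mul_of_nonneg_right h3 (abs_nonneg _))
        simp only [map_sub, map_smul, smul_eq_mul] at h1
        linarith

/-- A vector outside the span of `A` is separated from `A` by the dot product with some `v`. -/
theorem exists_dotProduct_ne_zero_of_notMem_span {n : ℕ} {A : Set (Fin n → ℝ)} {x : Fin n → ℝ}
    (hx : x ∉ Submodule.span ℝ A) :
    ∃ v : Fin n → ℝ, (∀ a ∈ A, a ⬝ᵥ v = 0) ∧ x ⬝ᵥ v ≠ 0 := by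
  obtain ⟨f, hfx, hf⟩ := Submodule.exists_le_ker_of_notMem hx
  have hdot : ∀ a, a ⬝ᵥ (fun j => f (Pi.single j 1)) = f a := fun a => by
    rw [LinearMap.pi_apply_eq_sum_univ f a]
    refine Finset.sum_congr rfl fun i _ => ?_
    refine congrArg (a i * f ·) (funext fun j => ?_)
    simp [Pi.single_apply, eq_comm]
  exact ⟨fun j => f (Pi.single j 1), fun a ha => by
    rw [hdot]; exact hf (Submodule.subset_span ha), by rwa [hdot]⟩

/-- Criterion for nonemptiness of the core (Section 4.1): for a simple arrangement
whose normals `uᵢ` span `ℝⁿ`, no region `Δ_ε` is a bounded nonempty `n`-dimensional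
polytope (i.e. the core is empty) iff some normal `u_k` does not lie in the linear span
of the remaining normals. -/
theorem core_empty_iff_some_normal_independent
    (m n d : ℕ) (hn : 1 ≤ n) (hd : d = m + n)
    (π : (Fin d → ℝ) →ₗ[ℝ] (Fin n → ℝ)) (hπ : Function.Surjective π)
    (u : Fin d → Fin n → ℝ) (hu : ∀ i, u i = π (Pi.single i 1))
    (lam : Fin d → ℝ)
    -- 𝒜 is simple
    (hsimple : ∀ S : Finset (Fin d),
        (⋂ i ∈ S, {y : Fin n → ℝ | (∑ j, u i j * y j) + lam i = 0}).Nonempty →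
        LinearIndependent ℝ (fun i : S => u i)) :
    (¬ ∃ ε : Fin d → ℝ, (∀ i, ε i = 1 ∨ ε i = -1) ∧
        {y : Fin n → ℝ | ∀ i, 0 ≤ ε i * ((∑ j, u i j * y j) + lam i)}.Nonempty ∧
        Bornology.IsBounded
          {y : Fin n → ℝ | ∀ i, 0 ≤ ε i * ((∑ j, u i j * y j) + lam i)} ∧
        (interior
          {y : Fin n → ℝ | ∀ i, 0 ≤ ε i * ((∑ j, u i j * y j) + lam i)}).Nonempty) ↔
      ∃ k : Fin d, u k ∉ Submodule.span ℝ (u '' {i | i ≠ k}) := by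
  change (¬ ∃ ε : Fin d → ℝ, (∀ i, ε i = 1 ∨ ε i = -1) ∧
      {y : Fin n → ℝ | ∀ i, 0 ≤ ε i * (u i ⬝ᵥ y + lam i)}.Nonempty ∧
      Bornology.IsBounded {y : Fin n → ℝ | ∀ i, 0 ≤ ε i * (u i ⬝ᵥ y + lam i)} ∧
      (interior {y : Fin n → ℝ | ∀ i, 0 ≤ ε i * (u i ⬝ᵥ y + lam i)}).Nonempty) ↔ _
  constructor
  · contrapose!
    intro hk
    have hspan : ∀ v : Fin n → ℝ, (∀ i, u i ⬝ᵥ v = 0) → v = 0 := by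
      intro v hv
      have h0 : (dotProductBilin ℝ ℝ v).comp π = 0 := by
        refine LinearMap.pi_ext' fun i => LinearMap.ext_ring ?_
        simpa [hu, dotProduct_comm] using hv i
      obtain ⟨x, hx⟩ := hπ v
      have := LinearMap.congr_fun h0 x
      simpa [hx] using this
    obtain ⟨ε, hε, ⟨y, -, hy⟩, hb⟩ := exists_bounded_region
      (fun i => dotProductBilin ℝ ℝ (u i)) lam
      (by
        intro T y hT i hi hyi
        have hli := hsimple (insert i T) ⟨y, by
          simp only [Set.mem_iInter]
          intro j hj
          rcases Finset.mem_insert.1 hj with rfl | hj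
          · exact hyi
          · exact hT j hj⟩
        have hli' : LinearIndepOn ℝ u (insert i (T : Set (Fin d))) := by
          rw [← Finset.coe_insert]; exact hli
        obtain ⟨v, hv, hvi⟩ := exists_dotProduct_ne_zero_of_notMem_span
          ((linearIndepOn_insert (by simpa using hi)).1 hli').2
        exact ⟨v, fun j hj => hv _ ⟨j, hj, rfl⟩, hvi⟩)
      Finset.univ ∅ (by simp) ⟨0, by simp⟩
      (fun v _ hv => hspan v fun i => hv i (Finset.mem_univ i))
      (by
        intro k _ v _ hv
        have hker : Submodule.span ℝ (u '' {i | i ≠ k}) ≤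
            LinearMap.ker (dotProductBilin ℝ ℝ v) := by
          rw [Submodule.span_le]
          rintro _ ⟨i, hi, rfl⟩
          simpa [dotProduct_comm] using hv i (Finset.mem_univ i) hi
        refine hspan v fun i => ?_
        by_cases hik : i = k
        · subst hik
          simpa [dotProduct_comm] using hker (hk i)
        · simpa using hv i (Finset.mem_univ i) hik)
    have hy' : ∀ i, 0 < ε i * (u i ⬝ᵥ y + lam i) := fun i => hy i (Finset.mem_univ i)
    refine ⟨ε, hε, ⟨y, fun i => (hy' i).le⟩, ?_, y, ?_⟩
    · choose C hC using fun j : Fin n => hb (LinearMap.proj j)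
      choose D hD using fun j : Fin n => hb (-LinearMap.proj j)
      refine (Metric.isBounded_Icc (fun j => -D j) C).subset fun z hz => ⟨fun j => ?_, fun j => ?_⟩
      · have := hD j z (by simp) fun i _ => hz i
        simp only [LinearMap.neg_apply, LinearMap.proj_apply] at this
        linarith
      · exact hC j z (by simp) fun i _ => hz i
    · refine mem_interior.2 ⟨{z | ∀ i, 0 < ε i * (u i ⬝ᵥ z + lam i)},
        fun z hz i => (hz i).le, ?_, hy'⟩
      simp only [Set.ofPred_forall, dotProduct]
      exact isOpen_iInter_of_finite fun i => isOpen_lt (by fun_prop) (by fun_prop)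
  · rintro ⟨k, hk⟩ ⟨ε, hε, ⟨y, hy⟩, hb, -⟩
    obtain ⟨v, hv, hvk⟩ := exists_dotProduct_ne_zero_of_notMem_span hk
    obtain ⟨M, hM⟩ := hb.exists_norm_le
    have hεk : ε k * ε k = 1 := by rcases hε k with h | h <;> simp [h]
    have hmem : ∀ t : ℝ, 0 ≤ t → ‖y + (t * (ε k * (u k ⬝ᵥ v))) • v‖ ≤ M := by
      refine fun t ht => hM _ fun i => ?_
      rw [dotProduct_add, dotProduct_smul, smul_eq_mul]
      by_cases hik : i = k
      · subst hik
        have h1 : 0 ≤ t * (u i ⬝ᵥ v) ^ 2 := by positivity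
        have h2 := hy i
        linear_combination h1 + h2 - t * (u i ⬝ᵥ v) ^ 2 * hεk
      · simpa [hv _ ⟨i, hik, rfl⟩] using hy i
    have hεk0 : ε k ≠ 0 := fun h => by simp [h] at hεk
    have hv0 : v ≠ 0 := fun h => hvk (by simp [h])
    obtain ⟨w, hw⟩ : ∃ w, w = (ε k * (u k ⬝ᵥ v)) • v := ⟨_, rfl⟩
    have hw0 : 0 < ‖w‖ := by
      rw [hw, norm_pos_iff]; exact smul_ne_zero (mul_ne_zero hεk0 hvk) hv0
    have hM0 : 0 ≤ M := (norm_nonneg _).trans (hM y hy)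
    have hlarge := hmem ((2 * M + 1) / ‖w‖) (by positivity)
    rw [mul_smul, ← hw] at hlarge
    have h1 : ‖((2 * M + 1) / ‖w‖) • w‖ = 2 * M + 1 := by
      rw [norm_smul, Real.norm_of_nonneg (by positivity)]
      field_simp
    have h2 := norm_sub_le (y + ((2 * M + 1) / ‖w‖) • w) y
    rw [add_sub_cancel_left, h1] at h2
    linarith [hM y hy]
end
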